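/- Fix x > 0 and α ∈ 𝒜. Let b be the simple-interest balance, i.e. the continuous function on [0,T] satisfying b_t = x + ∫_0^t ((r+β) p_s − α(s)) ds with p_s := inf_{0 ≤ u ≤ s} b_u, and let 𝔟_t := e^{(r+β)t}(x − ∫_0^t e^{−(r+β)s} α(s) ds) be the compound-interest balance. Then b_t ≤ 𝔟_t for all t ∈ [0,T]. -/

import Mathlib

open MeasureTheory Set

noncomputable section

/-- Admissible repayment strategies: measurable, with `m t ≤ α t ≤ M t` on `[0,T]`. -/
def Adm (T : ℝ) (m M : ℝ → ℝ) : Set (ℝ → ℝ) :=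
  {α | Measurable α ∧ ∀ t ∈ Icc (0:ℝ) T, m t ≤ α t ∧ α t ≤ M t}

/-- Running infimum of the balance: the principal. -/
def runInf (b : ℝ → ℝ) (t : ℝ) : ℝ := sInf (b '' Icc (0:ℝ) t)

/-- The simple-interest balance equation: `b` is continuous on `[0,T]`,
`b_t = x + ∫_0^t ((r+β) p_s − α_s) ds`, with `p` the running infimum of `b`. -/
def SimpleBal (r β T x : ℝ) (α b : ℝ → ℝ) : Prop :=
  ContinuousOn b (Icc (0:ℝ) T) ∧
  ∀ t ∈ Icc (0:ℝ) T, b t = x + ∫ s in (0:ℝ)..t, ((r + β) * runInf b s - α s)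

/-- Compound-interest balance. -/
def balC (r β x : ℝ) (α : ℝ → ℝ) (t : ℝ) : ℝ :=
  Real.exp ((r + β) * t) * (x - ∫ s in (0:ℝ)..t, Real.exp (-(r + β) * s) * α s)

/-- Product rule in integrated form for an exponential and the primitive of an integrable
function. -/
theorem integral_exp_mul_sub_primitive {g : ℝ → ℝ} {t : ℝ} (c x : ℝ)
    (hg : IntervalIntegrable g volume 0 t) :
    ∫ s in (0:ℝ)..t, Real.exp (-c * s) * (g s - c * (x + ∫ u in (0:ℝ)..s, g u)) =
      Real.exp (-c * t) * (x + ∫ u in (0:ℝ)..t, g u) - x := by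
  have hE : AbsolutelyContinuousOnInterval (fun s => Real.exp (-c * s)) 0 t := by
    apply ContDiffOn.absolutelyContinuousOnInterval
    fun_prop
  have hx : AbsolutelyContinuousOnInterval (fun _ : ℝ => x) 0 t := by
    apply ContDiffOn.absolutelyContinuousOnInterval
    fun_prop
  have hF : AbsolutelyContinuousOnInterval (fun s => x + ∫ u in (0:ℝ)..s, g u) 0 t :=
    hx.add (hg.absolutelyContinuousOnInterval_intervalIntegral left_mem_uIcc)
  have key := hE.integral_deriv_mul_eq_sub hF
  simp only [mul_zero, Real.exp_zero, intervalIntegral.integral_same, add_zero, one_mul] at key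
  rw [← key]
  apply intervalIntegral.integral_congr_ae
  filter_upwards [hg.ae_hasDerivAt_integral] with s hs hst
  have hderivF := ((hs (uIoc_subset_uIcc hst) 0 left_mem_uIcc).const_add x).deriv
  have hderivE : HasDerivAt (fun s => Real.exp (-c * s)) (Real.exp (-c * s) * (-c * 1)) s :=
    ((hasDerivAt_id s).const_mul (-c)).exp
  rw [hderivF, hderivE.deriv]
  ring

theorem bddBelow_image_Icc {b : ℝ → ℝ} {T t : ℝ} (hb : ContinuousOn b (Icc 0 T)) (ht : t ≤ T) :
    BddBelow (b '' Icc 0 t) :=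
  (isCompact_Icc.image_of_continuousOn (hb.mono (Icc_subset_Icc_right ht))).bddBelow

theorem runInf_le {b : ℝ → ℝ} {T t : ℝ} (hb : ContinuousOn b (Icc 0 T)) (ht : t ∈ Icc 0 T) :
    runInf b t ≤ b t :=
  csInf_le (bddBelow_image_Icc hb ht.2) (mem_image_of_mem b (right_mem_Icc.2 ht.1))

theorem antitoneOn_runInf {b : ℝ → ℝ} {T : ℝ} (hb : ContinuousOn b (Icc 0 T)) :
    AntitoneOn (runInf b) (Icc 0 T) := fun _ hs _ ht hst =>
  csInf_le_csInf (bddBelow_image_Icc hb ht.2) ((nonempty_Icc.2 hs.1).image b)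
    (image_mono (Icc_subset_Icc_right hst))

theorem integrableOn_of_mem_Adm {T : ℝ} {m M α : ℝ → ℝ}
    (hm : IntegrableOn m (Icc (0:ℝ) T)) (hM : IntegrableOn M (Icc (0:ℝ) T))
    (hα : α ∈ Adm T m M) : IntegrableOn α (Icc (0:ℝ) T) :=
  integrable_of_le_of_le hα.1.aestronglyMeasurable
    (ae_restrict_of_forall_mem measurableSet_Icc fun t ht => (hα.2 t ht).1)
    (ae_restrict_of_forall_mem measurableSet_Icc fun t ht => (hα.2 t ht).2) hm hM

/-- the simple-interest balance is dominated by the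
compound-interest balance on `[0,T]`. -/
theorem stmt19 (r β T : ℝ) (m M : ℝ → ℝ)
    (hr : 0 < r) (hβ : 0 < β) (hT : 0 < T)
    (hmMeas : Measurable m) (hMMeas : Measurable M)
    (hmInt : IntegrableOn m (Icc (0:ℝ) T)) (hMInt : IntegrableOn M (Icc (0:ℝ) T))
    (hmM : ∀ t ∈ Icc (0:ℝ) T, 0 < m t ∧ m t < M t)
    (x : ℝ) (hx : 0 < x)
    (α : ℝ → ℝ) (hα : α ∈ Adm T m M)
    (b : ℝ → ℝ) (hb : SimpleBal r β T x α b) :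
    ∀ t ∈ Icc (0:ℝ) T, b t ≤ balC r β x α t := by
  intro t ht
  obtain ⟨hcont, heq⟩ := hb
  have hsub : Icc 0 t ⊆ Icc 0 T := Icc_subset_Icc_right ht.2
  have hαint : IntervalIntegrable α volume 0 t :=
    (intervalIntegrable_iff_integrableOn_Icc_of_le ht.1).2
      ((integrableOn_of_mem_Adm hmInt hMInt hα).mono_set hsub)
  have hpint : IntervalIntegrable (runInf b) volume 0 t :=
    AntitoneOn.intervalIntegrable
      ((antitoneOn_runInf hcont).mono (by rwa [uIcc_of_le ht.1]))
  have hbint : IntervalIntegrable b volume 0 t :=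
    (hcont.mono hsub).intervalIntegrable_of_Icc ht.1
  have hg : IntervalIntegrable (fun s => (r + β) * runInf b s - α s) volume 0 t :=
    (hpint.const_mul _).sub hαint
  have hexp : ContinuousOn (fun s => Real.exp (-(r + β) * s)) (uIcc 0 t) := by fun_prop
  have hident := integral_exp_mul_sub_primitive (r + β) x hg
  rw [← heq t ht] at hident
  have hcongr : ∫ s in (0:ℝ)..t, Real.exp (-(r + β) * s) * ((r + β) * runInf b s - α s -
        (r + β) * (x + ∫ u in (0:ℝ)..s, ((r + β) * runInf b u - α u))) =
      ∫ s in (0:ℝ)..t, Real.exp (-(r + β) * s) *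
        ((r + β) * runInf b s - α s - (r + β) * b s) := by
    refine intervalIntegral.integral_congr fun s hs => ?_
    rw [uIcc_of_le ht.1] at hs
    simp only [heq s (hsub hs)]
  have hle : ∫ s in (0:ℝ)..t, Real.exp (-(r + β) * s) *
        ((r + β) * runInf b s - α s - (r + β) * b s) ≤
      ∫ s in (0:ℝ)..t, -(Real.exp (-(r + β) * s) * α s) := by
    refine intervalIntegral.integral_mono_on ht.1
      ((hg.sub (hbint.const_mul _)).continuousOn_mul hexp)
      (hαint.continuousOn_mul hexp).neg fun s hs => ?_
    have hp := mul_le_mul_of_nonneg_left (runInf_le hcont (hsub hs)) (add_pos hr hβ).le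
    rw [← mul_neg]
    exact mul_le_mul_of_nonneg_left (by linarith) (Real.exp_pos _).le
  rw [intervalIntegral.integral_neg] at hle
  have hdisc : Real.exp (-(r + β) * t) * b t ≤
      x - ∫ s in (0:ℝ)..t, Real.exp (-(r + β) * s) * α s := by linarith
  calc b t = Real.exp ((r + β) * t) * (Real.exp (-(r + β) * t) * b t) := by
        rw [← mul_assoc, ← Real.exp_add, neg_mul, add_neg_cancel, Real.exp_zero, one_mul]
    _ ≤ balC r β x α t := mul_le_mul_of_nonneg_left hdisc (Real.exp_pos _).le
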